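/- For every ε > 0 there is a constant C(ε, q) such that for every monic polynomial f ∈ F_q[t] and every integer g ≥ 1, | (1/#H_{2g+1}) ∑_{D ∈ H_{2g+1}} χ_D(f²) − ∏_{P | f} (1 − 1/(|P| + 1)) | ≤ C(ε, q) q^{ε(g + d(f))} q^{−2g}, where the product runs over the distinct monic irreducible divisors P of f. -/

import Mathlib

open Polynomial UniqueFactorizationMonoid
open scoped Classical

noncomputable section

/-- The quadratic residue symbol `(a/P)` for `P` a monic irreducible polynomial:
`0` if `P ∣ a`, `1` if `a` is a nonzero square mod `P`, `-1` otherwise. -/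
def resSym (q : ℕ) (a P : Polynomial (ZMod q)) : ℤ :=
  if P ∣ a then 0 else if ∃ b : Polynomial (ZMod q), P ∣ (a - b ^ 2) then 1 else -1

/-- The symbol `(a/b)`, extended multiplicatively over the monic irreducible factors
of `b` (with multiplicity); by convention `(a/0) = 0`.  In particular `χ_D(f) = (D/f)`
is `jacSym q D f`, and `χ_f(h) = (f/h)` is `jacSym q f h`. -/
def jacSym (q : ℕ) [Fact q.Prime] (a b : Polynomial (ZMod q)) : ℤ :=
  if b = 0 then 0 else ((normalizedFactors b).map fun P => resSym q a P).prod

/-- The monic polynomial of degree `n` determined by the vector `v` of its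
lower-order coefficients. -/
def monicOfDeg (q : ℕ) (n : ℕ) (v : Fin n → ZMod q) : Polynomial (ZMod q) :=
  X ^ n + ∑ i : Fin n, C (v i) * X ^ (i : ℕ)

/-- The polynomial of degree `< n` with coefficient vector `v`. -/
def polyLT (q : ℕ) (n : ℕ) (v : Fin n → ZMod q) : Polynomial (ZMod q) :=
  ∑ i : Fin n, C (v i) * X ^ (i : ℕ)

/-- Sum of `F` over all monic polynomials of degree `m`; empty for `m < 0`. -/
def sumMonic (q : ℕ) [NeZero q] {M : Type*} [AddCommMonoid M] (m : ℤ)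
    (F : Polynomial (ZMod q) → M) : M :=
  if 0 ≤ m then ∑ v : Fin m.toNat → ZMod q, F (monicOfDeg q m.toNat v) else 0

/-- Sum of `F` over all monic polynomials of degree `≤ n`; empty for `n < 0`. -/
def sumMonicLE (q : ℕ) [NeZero q] {M : Type*} [AddCommMonoid M] (n : ℤ)
    (F : Polynomial (ZMod q) → M) : M :=
  if 0 ≤ n then ∑ m ∈ Finset.range (n.toNat + 1), sumMonic q (m : ℤ) F else 0

/-- Sum of `F` over the set `H_{2g+1}` of monic squarefree polynomials of degree `2g+1`. -/
def sumH (q : ℕ) [NeZero q] {M : Type*} [AddCommMonoid M] (g : ℕ)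
    (F : Polynomial (ZMod q) → M) : M :=
  ∑ v : Fin (2 * g + 1) → ZMod q,
    if Squarefree (monicOfDeg q (2 * g + 1) v) then F (monicOfDeg q (2 * g + 1) v) else 0

/-- `e(a/f)` for monic `f`: the additive character `exp(2πi a₁/q)` where `a₁` is the
coefficient of `t⁻¹` in the expansion of `a/f` at infinity, namely the coefficient of
`t^{deg f - 1}` in `a mod f`. -/
def ePoly (q : ℕ) (a f : Polynomial (ZMod q)) : ℂ :=
  Complex.exp (2 * Real.pi * Complex.I *
    (((a %ₘ f).coeff (f.natDegree - 1)).val : ℂ) / q)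

/-- The generalized Gauss sum `G(V, f) = ∑_{u mod f} χ_f(u) e(uV/f)`, the sum running
over the residues `u` modulo `f`, i.e. the polynomials of degree `< deg f`. -/
def gaussS (q : ℕ) [Fact q.Prime] (V f : Polynomial (ZMod q)) : ℂ :=
  ∑ v : Fin f.natDegree → ZMod q,
    (jacSym q f (polyLT q f.natDegree v) : ℂ) * ePoly q (polyLT q f.natDegree v * V) f

/-- The von Mangoldt function: `Λ(f) = deg P` if `f = P^k` with `P` monic irreducible
and `k ≥ 1`, and `0` otherwise. -/
def vM (q : ℕ) (f : Polynomial (ZMod q)) : ℕ :=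
  if h : ∃ P : Polynomial (ZMod q), (∃ k : ℕ, 1 ≤ k ∧ f = P ^ k) ∧ P.Monic ∧ Irreducible P
  then h.choose.natDegree else 0

/-- The monic irreducible polynomials of `F_q[t]`. -/
abbrev MonicIrr (q : ℕ) := {P : Polynomial (ZMod q) // P.Monic ∧ Irreducible P}

/-- `B(α) = ∑_P d(P) / ((|P|^{1+2α} - 1)(|P| + 1))`, over monic irreducible `P`. -/
def Bsum (q : ℕ) (α : ℂ) : ℂ :=
  ∑' P : MonicIrr q, (P.1.natDegree : ℂ) /
    (((q : ℂ) ^ ((P.1.natDegree : ℂ) * (1 + 2 * α)) - 1) * ((q : ℂ) ^ P.1.natDegree + 1))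

end

section MonicCounting

variable {q : ℕ}

lemma monic_monicOfDeg [Fact q.Prime] (n : ℕ) (v : Fin n → ZMod q) :
    (monicOfDeg q n v).Monic :=
  monic_X_pow_add (degree_sum_fin_lt v)

lemma natDegree_monicOfDeg [Fact q.Prime] (n : ℕ) (v : Fin n → ZMod q) :
    (monicOfDeg q n v).natDegree = n := by
  refine natDegree_eq_of_degree_eq_some ?_
  rw [monicOfDeg, degree_add_eq_left_of_degree_lt] <;> rw [degree_X_pow]
  exact degree_sum_fin_lt v

lemma coeff_monicOfDeg (n : ℕ) (v : Fin n → ZMod q) (i : Fin n) :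
    (monicOfDeg q n v).coeff i = v i := by
  simp only [monicOfDeg, coeff_add, coeff_X_pow, finsetSum_coeff, coeff_C_mul]
  rw [if_neg i.2.ne, Finset.sum_eq_single i]
  · simp
  · intro j _ hj
    rw [if_neg (fun h => hj (Fin.ext h.symm)), mul_zero]
  · simp

lemma monicOfDeg_injective (n : ℕ) : Function.Injective (monicOfDeg q n) := by
  intro v w h
  ext i
  rw [← coeff_monicOfDeg n v i, ← coeff_monicOfDeg n w i, h]

variable (q) in
/-- The finset of monic polynomials of degree `n`. -/
noncomputable def monicsOfDeg [NeZero q] (n : ℕ) : Finset (Polynomial (ZMod q)) :=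
  Finset.univ.image (monicOfDeg q n)

variable [Fact q.Prime]

lemma mem_monicsOfDeg {n : ℕ} {D : Polynomial (ZMod q)} :
    D ∈ monicsOfDeg q n ↔ D.Monic ∧ D.natDegree = n := by
  constructor
  · intro h
    obtain ⟨v, -, rfl⟩ := Finset.mem_image.1 h
    exact ⟨monic_monicOfDeg n v, natDegree_monicOfDeg n v⟩
  · rintro ⟨hD, rfl⟩
    refine Finset.mem_image.2 ⟨fun i => D.coeff i, Finset.mem_univ _, ?_⟩
    conv_rhs => rw [hD.as_sum]
    rw [monicOfDeg, Finset.sum_range]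

lemma card_monicsOfDeg (n : ℕ) : (monicsOfDeg q n).card = q ^ n := by
  rw [monicsOfDeg, Finset.card_image_of_injective _ (monicOfDeg_injective n)]
  simp [ZMod.card]

variable (q) in
/-- The finset of monic squarefree polynomials of degree `n` divisible by no element of `S`. -/
noncomputable def squarefreePrimeTo (S : Finset (Polynomial (ZMod q))) (n : ℕ) :
    Finset (Polynomial (ZMod q)) :=
  (monicsOfDeg q n).filter fun D => Squarefree D ∧ ∀ P ∈ S, ¬ P ∣ D

lemma mem_squarefreePrimeTo {S : Finset (Polynomial (ZMod q))} {n : ℕ}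
    {D : Polynomial (ZMod q)} :
    D ∈ squarefreePrimeTo q S n ↔
      (D.Monic ∧ D.natDegree = n) ∧ Squarefree D ∧ ∀ P ∈ S, ¬ P ∣ D := by
  rw [squarefreePrimeTo, Finset.mem_filter, mem_monicsOfDeg]

lemma resSym_sq (a P : Polynomial (ZMod q)) :
    resSym q a P ^ 2 = if P ∣ a then 0 else 1 := by
  unfold resSym
  split_ifs <;> norm_num

lemma jacSym_sq {f : Polynomial (ZMod q)} (hf : f ≠ 0) (D : Polynomial (ZMod q)) :
    jacSym q D (f ^ 2) = if ∀ P ∈ (normalizedFactors f).toFinset, ¬ P ∣ D then 1 else 0 := by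
  rw [jacSym, if_neg (pow_ne_zero 2 hf), normalizedFactors_pow, Multiset.map_nsmul,
    Multiset.prod_nsmul, ← Multiset.prod_map_pow]
  simp only [resSym_sq]
  split_ifs with h
  · refine Multiset.prod_eq_one fun x hx => ?_
    obtain ⟨P, hP, rfl⟩ := Multiset.mem_map.1 hx
    rw [if_neg (h P (Multiset.mem_toFinset.2 hP))]
  · push Not at h
    obtain ⟨P, hP, hPD⟩ := h
    exact Multiset.prod_eq_zero
      (Multiset.mem_map.2 ⟨P, Multiset.mem_toFinset.1 hP, if_pos hPD⟩)

lemma sumH_jacSym_sq {f : Polynomial (ZMod q)} (hf : f ≠ 0) (g : ℕ) :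
    sumH q g (fun D => (jacSym q D (f ^ 2) : ℝ)) =
      ((squarefreePrimeTo q (normalizedFactors f).toFinset (2 * g + 1)).card : ℝ) := by
  rw [squarefreePrimeTo, Finset.card_filter, monicsOfDeg,
    Finset.sum_image (monicOfDeg_injective _).injOn, sumH]
  push_cast
  refine Finset.sum_congr rfl fun v _ => ?_
  rw [jacSym_sq hf]
  by_cases h : Squarefree (monicOfDeg q (2 * g + 1) v) <;> simp [h]

lemma exists_squarefree_mul_sq (D : Polynomial (ZMod q)) (hD : D.Monic) :
    ∃ A B : Polynomial (ZMod q), A.Monic ∧ B.Monic ∧ Squarefree A ∧ D = A * B ^ 2 := by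
  induction hn : D.natDegree using Nat.strong_induction_on generalizing D with
  | _ n ih =>
    by_cases hs : Squarefree D
    · exact ⟨D, 1, hD, monic_one, hs, by simp⟩
    · simp only [Squarefree, not_forall] at hs
      obtain ⟨x, hx, hu⟩ := hs
      have hx0 : x ≠ 0 := by
        rintro rfl
        exact hD.ne_zero (by simpa using hx)
      have hm : (normalize x).Monic := monic_normalize hx0
      have hdvd : normalize x * normalize x ∣ D :=
        (mul_dvd_mul (normalize_associated x).dvd (normalize_associated x).dvd).trans hx
      obtain ⟨E, hE⟩ := hdvd
      have hEm : E.Monic := (hm.mul hm).of_mul_monic_left (hE ▸ hD)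
      have hpos : 0 < (normalize x).natDegree := by
        refine hm.natDegree_pos_of_not_isUnit ?_
        rwa [(normalize_associated x).isUnit_iff]
      have hdeg : D.natDegree = (normalize x).natDegree + (normalize x).natDegree
          + E.natDegree := by
        rw [hE, (hm.mul hm).natDegree_mul hEm, hm.natDegree_mul hm]
      obtain ⟨A, B, hA, hB, hAs, hEAB⟩ := ih E.natDegree (by omega) E hEm rfl
      exact ⟨A, normalize x * B, hA, hm.mul hB, hAs, by rw [hE, hEAB]; ring⟩

lemma squarefree_mul_sq_injective {A B A' B' : Polynomial (ZMod q)} (hA : A.Monic)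
    (hB : B.Monic) (hA' : A'.Monic) (hB' : B'.Monic) (hs : Squarefree A)
    (hs' : Squarefree A') (h : A * B ^ 2 = A' * B' ^ 2) : A = A' ∧ B = B' := by
  have hBB : B = B' := by
    have key : normalizedFactors B = normalizedFactors B' := by
      have h2 := congrArg normalizedFactors h
      rw [normalizedFactors_mul hA.ne_zero (pow_ne_zero 2 hB.ne_zero),
        normalizedFactors_mul hA'.ne_zero (pow_ne_zero 2 hB'.ne_zero),
        normalizedFactors_pow, normalizedFactors_pow] at h2
      have n1 := (squarefree_iff_nodup_normalizedFactors hA.ne_zero).1 hs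
      have n2 := (squarefree_iff_nodup_normalizedFactors hA'.ne_zero).1 hs'
      ext P
      have h3 := congrArg (Multiset.count P) h2
      rw [Multiset.count_add, Multiset.count_add, Multiset.count_nsmul,
        Multiset.count_nsmul] at h3
      have := Multiset.nodup_iff_count_le_one.1 n1 P
      have := Multiset.nodup_iff_count_le_one.1 n2 P
      omega
    refine eq_of_monic_of_associated hB hB' ?_
    exact (associated_iff_normalizedFactors_eq_normalizedFactors hB.ne_zero hB'.ne_zero).2 key
  subst hBB
  exact ⟨mul_right_cancel₀ (pow_ne_zero 2 hB.ne_zero) h, rfl⟩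

lemma pow_eq_sum_card_squarefree (n : ℕ) :
    q ^ n = ∑ j ∈ Finset.range (n / 2 + 1),
      (squarefreePrimeTo q ∅ (n - 2 * j)).card * q ^ j := by
  have : ∀ j, (squarefreePrimeTo q ∅ (n - 2 * j)).card * q ^ j =
      (squarefreePrimeTo q ∅ (n - 2 * j) ×ˢ monicsOfDeg q j).card := fun j => by
    rw [Finset.card_product, card_monicsOfDeg]
  simp only [this]
  rw [← card_monicsOfDeg n, ← Finset.card_sigma]
  symm
  refine Finset.card_bij (fun x _ => x.2.1 * x.2.2 ^ 2) ?_ ?_ ?_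
  · rintro ⟨j, A, B⟩ hx
    simp only [Finset.mem_sigma, Finset.mem_range, Finset.mem_product, mem_squarefreePrimeTo,
      mem_monicsOfDeg] at hx ⊢
    obtain ⟨hj, ⟨⟨hA, hAd⟩, -⟩, hB, hBd⟩ := hx
    refine ⟨hA.mul (hB.pow 2), ?_⟩
    rw [hA.natDegree_mul (hB.pow 2), hB.natDegree_pow]
    omega
  · rintro ⟨j, A, B⟩ hx ⟨j', A', B'⟩ hx' h
    simp only [Finset.mem_sigma, Finset.mem_range, Finset.mem_product, mem_squarefreePrimeTo,
      mem_monicsOfDeg] at hx hx' h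
    obtain ⟨rfl, rfl⟩ := squarefree_mul_sq_injective hx.2.1.1.1 hx.2.2.1 hx'.2.1.1.1
      hx'.2.2.1 hx.2.1.2.1 hx'.2.1.2.1 h
    obtain rfl : j = j' := hx.2.2.2.symm.trans hx'.2.2.2
    rfl
  · intro D hD
    rw [mem_monicsOfDeg] at hD
    obtain ⟨A, B, hA, hB, hs, rfl⟩ := exists_squarefree_mul_sq D hD.1
    have hdeg := hD.2
    rw [hA.natDegree_mul (hB.pow 2), hB.natDegree_pow] at hdeg
    refine ⟨⟨B.natDegree, A, B⟩, ?_, rfl⟩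
    simp only [Finset.mem_sigma, Finset.mem_range, Finset.mem_product, mem_squarefreePrimeTo,
      mem_monicsOfDeg]
    exact ⟨by omega, ⟨⟨hA, by omega⟩, hs, by simp⟩, hB, trivial⟩

lemma card_squarefree_add_two (n : ℕ) :
    (squarefreePrimeTo q ∅ (n + 2)).card + q ^ (n + 1) = q ^ (n + 2) := by
  rw [pow_eq_sum_card_squarefree (n + 2), show (n + 2) / 2 + 1 = (n / 2 + 1) + 1 by omega,
    Finset.sum_range_succ', pow_succ, pow_eq_sum_card_squarefree n, Finset.sum_mul, add_comm]
  congr 1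
  · refine Finset.sum_congr rfl fun j _ => ?_
    rw [show n + 2 - 2 * (j + 1) = n - 2 * j by omega, pow_succ, mul_assoc]
  · simp

lemma card_squarefree_of_lt_two {n : ℕ} (hn : n < 2) :
    (squarefreePrimeTo q ∅ n).card = q ^ n := by
  rw [pow_eq_sum_card_squarefree n, show n / 2 = 0 by omega]
  simp

lemma dvd_mul_of_monic_irreducible {P Q E : Polynomial (ZMod q)} (hP : P.Monic ∧ Irreducible P)
    (hQ : Q.Monic ∧ Irreducible Q) (hne : Q ≠ P) (h : Q ∣ P * E) : Q ∣ E := by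
  refine (hQ.2.prime.dvd_or_dvd h).resolve_left fun hd => hne ?_
  exact eq_of_monic_of_associated hQ.1 hP.1 (hQ.2.associated_of_dvd hP.2 hd)

lemma card_squarefreePrimeTo_insert {S : Finset (Polynomial (ZMod q))}
    {P : Polynomial (ZMod q)} (hS : ∀ Q ∈ S, Q.Monic ∧ Irreducible Q)
    (hP : P.Monic ∧ Irreducible P) (hPS : P ∉ S) (m : ℕ) :
    (squarefreePrimeTo q (insert P S) (m + P.natDegree)).card +
      (squarefreePrimeTo q (insert P S) m).card =
      (squarefreePrimeTo q S (m + P.natDegree)).card := by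
  rw [← Finset.card_filter_add_card_filter_not (s := squarefreePrimeTo q S (m + P.natDegree))
    (fun D => ¬ P ∣ D)]
  congr 1
  · congr 1
    ext D
    simp only [Finset.mem_filter, mem_squarefreePrimeTo, Finset.forall_mem_insert]
    tauto
  · refine Finset.card_bij (fun E _ => P * E) ?_ ?_ ?_
    · intro E hE
      rw [mem_squarefreePrimeTo, Finset.forall_mem_insert] at hE
      obtain ⟨⟨hEm, hEd⟩, hEs, hPE, hSE⟩ := hE
      rw [Finset.mem_filter, mem_squarefreePrimeTo, not_not]
      refine ⟨⟨⟨hP.1.mul hEm, ?_⟩, ?_, fun Q hQ hd => ?_⟩, dvd_mul_right _ _⟩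
      · rw [hP.1.natDegree_mul hEm, hEd, add_comm]
      · exact squarefree_mul_iff.2
          ⟨hP.2.isRelPrime_iff_not_dvd.2 hPE, hP.2.squarefree, hEs⟩
      · exact hSE Q hQ (dvd_mul_of_monic_irreducible hP (hS Q hQ)
          (fun h => hPS (h ▸ hQ)) hd)
    · intro E _ E' _ h
      exact mul_left_cancel₀ hP.1.ne_zero h
    · intro D hD
      rw [Finset.mem_filter, mem_squarefreePrimeTo, not_not] at hD
      obtain ⟨⟨⟨hDm, hDd⟩, hDs, hSD⟩, E, rfl⟩ := hD
      have hEm : E.Monic := hP.1.of_mul_monic_left hDm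
      rw [hP.1.natDegree_mul hEm] at hDd
      obtain ⟨hrel, -, hEs⟩ := squarefree_mul_iff.1 hDs
      refine ⟨E, ?_, rfl⟩
      rw [mem_squarefreePrimeTo, Finset.forall_mem_insert]
      exact ⟨⟨hEm, by omega⟩, hEs, hP.2.isRelPrime_iff_not_dvd.1 hrel,
        fun Q hQ hd => hSD Q hQ (hd.mul_left P)⟩

lemma squarefreePrimeTo_insert_of_lt (S : Finset (Polynomial (ZMod q)))
    {P : Polynomial (ZMod q)} {n : ℕ} (hn : n < P.natDegree) :
    squarefreePrimeTo q (insert P S) n = squarefreePrimeTo q S n := by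
  ext D
  simp only [mem_squarefreePrimeTo, Finset.forall_mem_insert]
  constructor
  · tauto
  · rintro ⟨⟨hm, hd⟩, hs, hS⟩
    refine ⟨⟨hm, hd⟩, hs, fun h => ?_, hS⟩
    have := natDegree_le_of_dvd h hm.ne_zero
    omega

lemma one_sub_inv_pow_pos {x : ℝ} (hx : 1 < x) {d : ℕ} (hd : 0 < d) : 0 < 1 - (x ^ d)⁻¹ :=
  sub_pos.2 (inv_lt_one_of_one_lt₀ (one_lt_pow₀ hx hd.ne'))

lemma abs_card_squarefreePrimeTo_sub_le {x : ℝ} (hx : 1 < x) (hxq : x ≤ q)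
    (S : Finset (Polynomial (ZMod q))) (hS : ∀ Q ∈ S, Q.Monic ∧ Irreducible Q) (n : ℕ) :
    |((squarefreePrimeTo q S n).card : ℝ) - (1 - (q : ℝ)⁻¹) * (q : ℝ) ^ n *
        ∏ P ∈ S, (1 - 1 / ((q : ℝ) ^ P.natDegree + 1))| ≤
      (∏ P ∈ S, (1 - (x ^ P.natDegree)⁻¹)⁻¹) * x ^ n := by
  have hq : (1 : ℝ) < q := hx.trans_le hxq
  have hq0 : (0 : ℝ) < q := by linarith
  have hqi0 : 0 < (q : ℝ)⁻¹ := by positivity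
  have hqi : (q : ℝ)⁻¹ < 1 := inv_lt_one_of_one_lt₀ hq
  have hx0 : 0 < x := by linarith
  induction S using Finset.induction_on generalizing n with
  | empty =>
    simp only [Finset.prod_empty, mul_one, one_mul]
    rcases lt_or_ge n 2 with hn | hn
    · rw [card_squarefree_of_lt_two hn]
      have : ((q ^ n : ℕ) : ℝ) - (1 - (q : ℝ)⁻¹) * (q : ℝ) ^ n = (q : ℝ)⁻¹ * (q : ℝ) ^ n := by
        push_cast; ring
      rw [this, abs_of_pos (by positivity)]
      interval_cases n
      · simpa using hqi.le
      · rw [pow_one, inv_mul_cancel₀ hq0.ne']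
        simpa using hx.le
    · obtain ⟨m, rfl⟩ := Nat.exists_eq_add_of_le' hn
      have h : ((squarefreePrimeTo q ∅ (m + 2)).card : ℝ) + (q : ℝ) ^ (m + 1) =
          (q : ℝ) ^ (m + 2) := by exact_mod_cast card_squarefree_add_two (q := q) m
      have h2 : (q : ℝ)⁻¹ * (q : ℝ) ^ (m + 2) = (q : ℝ) ^ (m + 1) := by
        rw [pow_succ' _ (m + 1), inv_mul_cancel_left₀ hq0.ne']
      have : ((squarefreePrimeTo q ∅ (m + 2)).card : ℝ) -
          (1 - (q : ℝ)⁻¹) * (q : ℝ) ^ (m + 2) = 0 := by linarith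
      rw [this, abs_zero]
      positivity
  | insert P S hPS ih =>
    have hS' : ∀ Q ∈ S, Q.Monic ∧ Irreducible Q := fun Q hQ =>
      hS Q (Finset.mem_insert_of_mem hQ)
    have hP := hS P (Finset.mem_insert_self _ _)
    have hd : 0 < P.natDegree := hP.2.natDegree_pos
    replace ih := ih hS'
    rw [Finset.prod_insert hPS, Finset.prod_insert hPS]
    set d := P.natDegree with hdd
    set M := ∏ P ∈ S, (1 - 1 / ((q : ℝ) ^ P.natDegree + 1)) with hM
    set B := ∏ P ∈ S, (1 - (x ^ P.natDegree)⁻¹)⁻¹ with hB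
    have hM0 : 0 ≤ M := Finset.prod_nonneg fun Q _ => by
      rw [sub_nonneg, div_le_one (by positivity)]
      linarith [pow_pos hq0 Q.natDegree]
    have hM1 : M ≤ 1 := Finset.prod_le_one (fun Q _ => by
      rw [sub_nonneg, div_le_one (by positivity)]
      linarith [pow_pos hq0 Q.natDegree]) fun Q _ => by
        have : 0 < 1 / ((q : ℝ) ^ Q.natDegree + 1) := by positivity
        linarith
    have hB1 : 1 ≤ B := by
      rw [hB]
      refine Finset.one_le_prod fun Q hQ => ?_
      have hQd : 0 < Q.natDegree := (hS' Q hQ).2.natDegree_pos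
      refine (one_le_inv₀ (one_sub_inv_pow_pos hx hQd)).2 ?_
      have : 0 < (x ^ Q.natDegree)⁻¹ := by positivity
      linarith
    have hc := one_sub_inv_pow_pos hx hd
    set c := (1 - (x ^ d)⁻¹)⁻¹ with hcd
    have hcc : c = 1 + c * (x ^ d)⁻¹ := by
      have : c * (1 - (x ^ d)⁻¹) = 1 := inv_mul_cancel₀ hc.ne'
      linarith
    have hc1 : 1 ≤ c := by
      have : 0 < c := inv_pos.2 hc
      have : 0 < c * (x ^ d)⁻¹ := by positivity
      linarith
    set M' := (1 - 1 / ((q : ℝ) ^ d + 1)) * M with hM'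
    have hMM : M = M' + M' / (q : ℝ) ^ d := by
      rw [hM']
      field_simp
      ring
    have hM'0 : 0 ≤ M' := by
      refine mul_nonneg ?_ hM0
      rw [sub_nonneg, div_le_one (by positivity)]
      linarith [pow_pos hq0 d]
    have hM'1 : M' ≤ 1 := by
      have : 0 ≤ M' / (q : ℝ) ^ d := by positivity
      linarith
    have hcB : 1 ≤ c * B := one_le_mul_of_one_le_of_one_le hc1 hB1
    clear_value M' M B c
    induction n using Nat.strong_induction_on with
    | _ n ihn =>
      have hsplit : c * B * x ^ n = B * x ^ n + c * B * (x ^ n / x ^ d) := by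
        conv_lhs => rw [hcc]
        ring
      rw [hsplit]
      rcases lt_or_ge n d with hn | hn
      · rw [squarefreePrimeTo_insert_of_lt S hn]
        have h1 : ((squarefreePrimeTo q S n).card : ℝ) - (1 - (q : ℝ)⁻¹) * (q : ℝ) ^ n * M' =
            (((squarefreePrimeTo q S n).card : ℝ) - (1 - (q : ℝ)⁻¹) * (q : ℝ) ^ n * M) +
              (1 - (q : ℝ)⁻¹) * M' * ((q : ℝ) ^ n / (q : ℝ) ^ d) := by
          conv_rhs => rw [hMM]
          ring
        rw [h1]
        refine (abs_add_le _ _).trans (add_le_add (ih n) ?_)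
        have h2 : (q : ℝ) ^ n / (q : ℝ) ^ d ≤ x ^ n / x ^ d := by
          obtain ⟨k, hk⟩ := Nat.exists_eq_add_of_le hn.le
          rw [hk, pow_add, pow_add, div_mul_eq_div_div, div_mul_eq_div_div,
            div_self (by positivity), div_self (by positivity)]
          exact one_div_le_one_div_of_le (by positivity) (pow_le_pow_left₀ hx0.le hxq k)
        have h3 : 0 ≤ (1 - (q : ℝ)⁻¹) := by linarith
        have h4 : (1 - (q : ℝ)⁻¹) * M' ≤ 1 := mul_le_one₀ (by linarith) hM'0 hM'1
        have h5 : 0 ≤ (q : ℝ) ^ n / (q : ℝ) ^ d := by positivity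
        rw [abs_of_nonneg (mul_nonneg (mul_nonneg h3 hM'0) h5)]
        exact mul_le_mul (h4.trans hcB) h2 h5 (by linarith)
      · obtain ⟨m, rfl⟩ := Nat.exists_eq_add_of_le' hn
        have hrec : ((squarefreePrimeTo q (insert P S) (m + d)).card : ℝ) +
            (squarefreePrimeTo q (insert P S) m).card =
            (squarefreePrimeTo q S (m + d)).card := by
          exact_mod_cast card_squarefreePrimeTo_insert hS' hP hPS m
        have h1 : ((squarefreePrimeTo q (insert P S) (m + d)).card : ℝ) -
              (1 - (q : ℝ)⁻¹) * (q : ℝ) ^ (m + d) * M' =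
            (((squarefreePrimeTo q S (m + d)).card : ℝ) -
              (1 - (q : ℝ)⁻¹) * (q : ℝ) ^ (m + d) * M) -
            (((squarefreePrimeTo q (insert P S) m).card : ℝ) -
              (1 - (q : ℝ)⁻¹) * (q : ℝ) ^ m * M') := by
          have : (q : ℝ) ^ (m + d) * M = (q : ℝ) ^ (m + d) * M' + (q : ℝ) ^ m * M' := by
            rw [hMM, pow_add]
            field_simp
          rw [← hrec, mul_assoc _ _ M, this]
          ring
        rw [h1]
        have hxx : x ^ (m + d) / x ^ d = x ^ m := by
          rw [pow_add, mul_div_assoc, div_self (by positivity), mul_one]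
        rw [hxx]
        exact (abs_sub _ _).trans (add_le_add (ih _) (ihn m (by omega)))

lemma sum_natDegree_normalizedFactors_le {f : Polynomial (ZMod q)} (hf : f ≠ 0) :
    ∑ P ∈ (normalizedFactors f).toFinset, P.natDegree ≤ f.natDegree := by
  have hdvd : ∏ P ∈ (normalizedFactors f).toFinset, P ∣ f := by
    refine dvd_trans ?_ (prod_normalizedFactors hf).dvd
    rw [Finset.prod, Multiset.map_id', Multiset.toFinset_val]
    exact Multiset.prod_dvd_prod_of_le (Multiset.dedup_le _)
  rw [← natDegree_prod]
  · exact natDegree_le_of_dvd hdvd hf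
  · intro P hP
    exact (irreducible_of_normalized_factor P (Multiset.mem_toFinset.1 hP)).ne_zero

lemma exists_prod_inv_one_sub_le {x : ℝ} (hx : 1 < x) :
    ∃ K : ℝ, 0 < K ∧ ∀ S : Finset (Polynomial (ZMod q)),
      (∀ Q ∈ S, Q.Monic ∧ Irreducible Q) →
      ∏ P ∈ S, (1 - (x ^ P.natDegree)⁻¹)⁻¹ ≤ K * x ^ ∑ P ∈ S, P.natDegree := by
  obtain ⟨d₀, hd₀⟩ := pow_unbounded_of_one_lt 2 hx
  have hx0 : 0 < x := by linarith
  have hc0 : 0 < 1 - x⁻¹ := by simpa using one_sub_inv_pow_pos hx one_pos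
  set T := (Finset.range d₀).biUnion (monicsOfDeg q)
  set c := (1 - x⁻¹)⁻¹
  have hc1 : 1 ≤ c := (one_le_inv₀ hc0).2 (by linarith [inv_pos.2 hx0])
  refine ⟨c ^ T.card, by positivity, fun S hS => ?_⟩
  calc ∏ P ∈ S, (1 - (x ^ P.natDegree)⁻¹)⁻¹
      ≤ ∏ P ∈ S, ((if P ∈ T then c else 1) * x ^ P.natDegree) := by
        refine Finset.prod_le_prod (fun P hP => ?_) fun P hP => ?_
        · exact (inv_pos.2 (one_sub_inv_pow_pos hx (hS P hP).2.natDegree_pos)).le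
        have hd : 0 < P.natDegree := (hS P hP).2.natDegree_pos
        split_ifs with hT
        · have h1 : (1 - (x ^ P.natDegree)⁻¹)⁻¹ ≤ c := by
            refine inv_anti₀ hc0 (sub_le_sub_left (inv_anti₀ hx0 ?_) _)
            exact le_self_pow₀ hx.le hd.ne'
          exact h1.trans (le_mul_of_one_le_right (by linarith) (one_le_pow₀ hx.le))
        · have hdd : d₀ ≤ P.natDegree := by
            by_contra! hlt
            exact hT (Finset.mem_biUnion.2 ⟨_, Finset.mem_range.2 hlt,
              mem_monicsOfDeg.2 ⟨(hS P hP).1, rfl⟩⟩)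
          have h2 : 2 ≤ x ^ P.natDegree := hd₀.le.trans (pow_le_pow_right₀ hx.le hdd)
          have h3 : (x ^ P.natDegree)⁻¹ ≤ 2⁻¹ := inv_anti₀ two_pos h2
          have h4 : (1 - (x ^ P.natDegree)⁻¹)⁻¹ ≤ (2⁻¹)⁻¹ :=
            inv_anti₀ (by norm_num) (by linarith)
          rw [inv_inv] at h4
          linarith
    _ = c ^ (S.filter (· ∈ T)).card * x ^ ∑ P ∈ S, P.natDegree := by
        rw [Finset.prod_mul_distrib, Finset.prod_pow_eq_pow_sum, Finset.prod_ite]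
        simp
    _ ≤ c ^ T.card * x ^ ∑ P ∈ S, P.natDegree := by
        refine mul_le_mul_of_nonneg_right (pow_le_pow_right₀ hc1 ?_) (by positivity)
        exact Finset.card_le_card fun P hP => (Finset.mem_filter.1 hP).2

end MonicCounting

/-- Lemma 3.7 of [bf]: for every `ε > 0` there is `C(ε,q)` with
`|(1/#H_{2g+1}) ∑_{D ∈ H_{2g+1}} χ_D(f²) - ∏_{P | f} (1 - 1/(|P|+1))|
  ≤ C q^{ε(g + d(f))} q^{-2g}` for all monic `f` and all `g ≥ 1`. -/
theorem statement8 (q : ℕ) [Fact q.Prime] (hq4 : q % 4 = 1) (ε : ℝ) (hε : 0 < ε) :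
    ∃ C : ℝ, 0 < C ∧ ∀ f : Polynomial (ZMod q), f.Monic → ∀ g : ℕ, 1 ≤ g →
      |(1 / ((q : ℝ) ^ (2 * g + 1) - (q : ℝ) ^ (2 * g))) *
            sumH q g (fun D => (jacSym q D (f ^ 2) : ℝ))
          - ∏ P ∈ (normalizedFactors f).toFinset, (1 - 1 / ((q : ℝ) ^ P.natDegree + 1))|
        ≤ C * (q : ℝ) ^ (ε * ((g : ℝ) + f.natDegree)) * (q : ℝ) ^ (-(2 : ℝ) * g) := by
  have hq1 : (1 : ℝ) < q := by exact_mod_cast (Fact.out : q.Prime).one_lt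
  have hq2 : (2 : ℝ) ≤ q := by exact_mod_cast (Fact.out : q.Prime).two_le
  have hq0 : (0 : ℝ) < q := by linarith
  set δ : ℝ := min (ε / 3) 1 with hδ
  have hδ0 : 0 < δ := lt_min (by linarith) one_pos
  have hδ3 : 3 * δ ≤ ε := by linarith [min_le_left (ε / 3) 1]
  set x : ℝ := (q : ℝ) ^ δ with hxdef
  have hx : 1 < x := Real.one_lt_rpow hq1 hδ0
  have hxq : x ≤ q := by
    simpa using Real.rpow_le_rpow_of_exponent_le hq1.le (min_le_right (ε / 3) 1)
  have hx0 : 0 < x := by linarith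
  obtain ⟨K, hK0, hK⟩ := exists_prod_inv_one_sub_le (q := q) hx
  refine ⟨K, hK0, fun f hf g hg => ?_⟩
  rw [sumH_jacSym_sq hf.ne_zero]
  set S := (normalizedFactors f).toFinset with hSdef
  have hS : ∀ Q ∈ S, Q.Monic ∧ Irreducible Q := fun Q hQ => by
    have hQ' := Multiset.mem_toFinset.1 hQ
    have hirr := irreducible_of_normalized_factor Q hQ'
    refine ⟨?_, hirr⟩
    rw [← normalize_normalized_factor Q hQ']
    exact monic_normalize hirr.ne_zero
  have key := abs_card_squarefreePrimeTo_sub_le hx hxq S hS (2 * g + 1)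
  set N := ((squarefreePrimeTo q S (2 * g + 1)).card : ℝ)
  set M := ∏ P ∈ S, (1 - 1 / ((q : ℝ) ^ P.natDegree + 1))
  set h := (q : ℝ) ^ (2 * g + 1) - (q : ℝ) ^ (2 * g) with hh
  have hheq : (1 - (q : ℝ)⁻¹) * (q : ℝ) ^ (2 * g + 1) = h := by
    rw [hh, pow_succ]
    field_simp
  have hhle : (q : ℝ) ^ (2 * g) ≤ h := by
    have : (q : ℝ) ^ (2 * g) * 2 ≤ (q : ℝ) ^ (2 * g + 1) := by
      rw [pow_succ]
      gcongr
    linarith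
  have hpow : 0 < (q : ℝ) ^ (2 * g) := by positivity
  have hh0 : 0 < h := hpow.trans_le hhle
  rw [hheq] at key
  have hE : 1 / h * N - M = (N - h * M) / h := by
    field_simp
  have hxf : x ^ (2 * g + 1) * x ^ f.natDegree ≤ (q : ℝ) ^ (ε * ((g : ℝ) + f.natDegree)) := by
    rw [← pow_add, hxdef, ← Real.rpow_natCast, ← Real.rpow_mul hq0.le]
    refine Real.rpow_le_rpow_of_exponent_le hq1.le ?_
    push_cast
    have hg' : (1 : ℝ) ≤ g := by exact_mod_cast hg
    have hf' : (0 : ℝ) ≤ f.natDegree := Nat.cast_nonneg _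
    calc δ * (2 * g + 1 + f.natDegree) ≤ δ * (3 * (g + f.natDegree)) := by
          gcongr
          linarith
      _ = 3 * δ * (g + f.natDegree) := by ring
      _ ≤ ε * (g + f.natDegree) := by gcongr
  have hneg : (q : ℝ) ^ (-(2 : ℝ) * g) = ((q : ℝ) ^ (2 * g))⁻¹ := by
    rw [neg_mul, Real.rpow_neg hq0.le, ← Real.rpow_natCast]
    push_cast
    rfl
  rw [hE, abs_div, abs_of_pos hh0, hneg, div_eq_mul_inv]
  refine mul_le_mul ?_ (inv_anti₀ hpow hhle) (by positivity) (by positivity)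
  calc |N - h * M| ≤ (∏ P ∈ S, (1 - (x ^ P.natDegree)⁻¹)⁻¹) * x ^ (2 * g + 1) := key
    _ ≤ K * x ^ f.natDegree * x ^ (2 * g + 1) := by
        gcongr
        refine (hK S hS).trans ?_
        gcongr
        · exact hx.le
        · exact sum_natDegree_normalizedFactors_le hf.ne_zero
    _ = K * (x ^ (2 * g + 1) * x ^ f.natDegree) := by ring
    _ ≤ K * (q : ℝ) ^ (ε * ((g : ℝ) + f.natDegree)) := by gcongr
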